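/- Let q > 2 be a power of 2 and c_1 ∈ F_q with c_1 ≠ 0. Let F : F_q → F_q be given by F(x) = (x^{q−2} + c_1)^{q−2} + x (the case c_0 = 1). Then the value set V_F = {F(c) : c ∈ F_q} has cardinality #V_F = q/2 + Tr(1) − 1, where Tr(1) is interpreted as the integer 0 or 1. -/

import Mathlib

open scoped Classical

/-- The absolute trace `Tr : F_{2^m} → F_2 ⊆ F_{2^m}`, `Tr(x) = ∑_{i<m} x^{2^i}`. -/
def absTr {K : Type*} [Field K] (m : ℕ) (x : K) : K :=
  ∑ i ∈ Finset.range m, x ^ 2 ^ i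

theorem FiniteField.pow_card_sub_two {K : Type*} [Field K] [Fintype K]
    (hK : 2 < Fintype.card K) (x : K) : x ^ (Fintype.card K - 2) = x⁻¹ := by
  by_cases hx : x = 0
  · subst hx
    rw [zero_pow (by omega), inv_zero]
  · apply eq_inv_of_mul_eq_one_left
    rw [← pow_succ, ← FiniteField.pow_card_sub_one_eq_one x hx]
    congr 1
    omega

theorem three_dvd_two_pow_sub_one_iff (m : ℕ) : 3 ∣ 2 ^ m - 1 ↔ Even m := by
  have h4 (k : ℕ) : 4 ^ k % 3 = 1 := by simp [Nat.pow_mod]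
  rcases Nat.even_or_odd' m with ⟨k, rfl | rfl⟩
  · have := h4 k
    rw [pow_mul]
    norm_num
    omega
  · have := h4 k
    have hk : ¬ Even (2 * k + 1) := by simp
    rw [pow_succ, pow_mul]
    norm_num
    omega

theorem FiniteField.exists_sq_add_self_add_one_eq_zero_iff {K : Type*} [Field K] [Fintype K]
    [CharP K 2] : (∃ z : K, z ^ 2 + z + 1 = 0) ↔ 3 ∣ Fintype.card K - 1 := by
  have h2 : (2 : K) = 0 := CharTwo.two_eq_zero
  constructor
  · rintro ⟨z, hz⟩
    have hz3 : z ^ 3 = 1 := by linear_combination (z - 1) * hz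
    have hz0 : z ≠ 0 := by rintro rfl; simp at hz
    have hz1 : z ≠ 1 := by
      rintro rfl
      exact one_ne_zero (α := K) (by linear_combination hz - h2)
    have : Fact (Nat.Prime 3) := ⟨Nat.prime_three⟩
    rw [← orderOf_eq_prime hz3 hz1]
    exact orderOf_dvd_of_pow_eq_one (FiniteField.pow_card_sub_one_eq_one z hz0)
  · intro h
    have : Fact (Nat.Prime 3) := ⟨Nat.prime_three⟩
    rw [← Fintype.card_units] at h
    obtain ⟨u, hu⟩ := exists_prime_orderOf_dvd_card 3 h
    have hu3 : (u : K) ^ 3 = 1 := by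
      rw [← Units.val_pow_eq_pow_val, ← hu, pow_orderOf_eq_one, Units.val_one]
    have hu1 : (u : K) - 1 ≠ 0 := by
      intro h1
      have : u = 1 := Units.ext (by simpa [sub_eq_zero] using h1)
      simp [this] at hu
    refine ⟨u, (mul_eq_zero.mp ?_).resolve_left hu1⟩
    linear_combination hu3

theorem absTr_one {K : Type*} [Field K] (m : ℕ) : absTr m (1 : K) = m := by
  simp [absTr]

theorem add_inv_eq_add_inv_iff {K : Type*} [Field K] {z w : K} (hz : z ≠ 0) (hw : w ≠ 0) :
    w + w⁻¹ = z + z⁻¹ ↔ w = z ∨ w = z⁻¹ := by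
  constructor
  · intro h
    have key : (w - z) * (w * z - 1) = 0 := by
      field_simp at h
      linear_combination h
    rcases mul_eq_zero.mp key with h | h
    · exact Or.inl (sub_eq_zero.mp h)
    · exact Or.inr (eq_inv_of_mul_eq_one_left (sub_eq_zero.mp h))
  · rintro (rfl | rfl)
    · rfl
    · rw [inv_inv, add_comm]

theorem two_mul_card_image_add_inv {K : Type*} [Field K] [Fintype K] [CharP K 2] :
    2 * ((Finset.univ \ {0, 1} : Finset K).image fun z => z + z⁻¹).card =
      Fintype.card K - 2 := by
  have hS : (Finset.univ \ {0, 1} : Finset K).card = Fintype.card K - 2 := by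
    rw [Finset.card_sdiff_of_subset (Finset.subset_univ _), Finset.card_univ,
      Finset.card_pair zero_ne_one]
  rw [← hS, Finset.card_eq_sum_card_image (fun z : K => z + z⁻¹) (Finset.univ \ {0, 1}),
    Finset.sum_const_nat (m := 2), mul_comm]
  intro b hb
  obtain ⟨z, hz, rfl⟩ := Finset.mem_image.mp hb
  simp only [Finset.mem_sdiff, Finset.mem_univ, true_and, Finset.mem_insert,
    Finset.mem_singleton, not_or] at hz
  obtain ⟨hz0, hz1⟩ := hz
  have hne : z ≠ z⁻¹ := by
    intro h
    have hzz : z * z = 1 := by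
      nth_rewrite 2 [h]
      exact mul_inv_cancel₀ hz0
    have h2 : (2 : K) = 0 := CharTwo.two_eq_zero
    have : (z - 1) ^ 2 = 0 := by linear_combination hzz + (1 - z) * h2
    exact hz1 (sub_eq_zero.mp (pow_eq_zero_iff two_ne_zero |>.mp this))
  rw [← Finset.card_pair hne]
  congr 1
  ext w
  simp only [Finset.mem_filter, Finset.mem_sdiff, Finset.mem_univ, true_and, Finset.mem_insert,
    Finset.mem_singleton, not_or]
  constructor
  · rintro ⟨⟨hw0, -⟩, h⟩
    exact (add_inv_eq_add_inv_iff hz0 hw0).mp h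
  · intro h
    have hw : w ≠ 0 ∧ w ≠ 1 := by
      rcases h with rfl | rfl
      · exact ⟨hz0, hz1⟩
      · exact ⟨inv_ne_zero hz0, by simpa using hz1⟩
    exact ⟨hw, (add_inv_eq_add_inv_iff hz0 hw.1).mpr h⟩

theorem range_inv_add_inv_add_self {K : Type*} [Field K] [Fintype K] [CharP K 2]
    {c : K} (hc : c ≠ 0) :
    Set.range (fun x : K => (x⁻¹ + c)⁻¹ + x) = (fun y => c⁻¹ * y) ''
      ↑(insert 1 ((Finset.univ \ {0, 1} : Finset K).image fun z => z + z⁻¹)) := by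
  have h2 : (2 : K) = 0 := CharTwo.two_eq_zero
  have key (z : K) (hz0 : z ≠ 0) (hz1 : z ≠ 1) :
      ((c⁻¹ * (z + 1))⁻¹ + c)⁻¹ + c⁻¹ * (z + 1) = c⁻¹ * (z + z⁻¹) := by
    have hz1' : z + 1 ≠ 0 := fun h => hz1 (CharTwo.add_eq_zero.mp h)
    have hs : (c⁻¹ * (z + 1))⁻¹ + c = c * z * (z + 1)⁻¹ := by
      field_simp
      linear_combination h2
    rw [hs]
    field_simp
    linear_combination z * h2
  ext y
  simp only [Set.mem_range, Set.mem_image, Finset.coe_insert, Finset.coe_image, Finset.coe_sdiff,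
    Finset.coe_univ, Set.mem_insert_iff, exists_eq_or_imp, Set.mem_sdiff, Set.mem_univ, true_and,
    Finset.coe_singleton, Set.mem_singleton_iff, not_or, exists_exists_and_eq_and]
  constructor
  · rintro ⟨x, rfl⟩
    by_cases hx0 : x = 0
    · exact Or.inl (by simp [hx0])
    by_cases hx1 : x = c⁻¹
    · exact Or.inl (by simp [hx1, CharTwo.add_self_eq_zero])
    have hx : c⁻¹ * (c * x + 1 + 1) = x := by
      rw [add_assoc, CharTwo.add_self_eq_zero, add_zero, inv_mul_cancel_left₀ hc]
    have hz0 : c * x + 1 ≠ 0 := fun h =>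
      hx1 (eq_inv_of_mul_eq_one_right (CharTwo.add_eq_zero.mp h))
    have hz1 : c * x + 1 ≠ 1 := by simp [hc, hx0]
    refine Or.inr ⟨c * x + 1, ⟨hz0, hz1⟩, ?_⟩
    rw [← key _ hz0 hz1, hx]
  · rintro (rfl | ⟨z, ⟨hz0, hz1⟩, rfl⟩)
    · exact ⟨0, by simp⟩
    · exact ⟨_, key z hz0 hz1⟩

theorem one_mem_image_add_inv_iff {K : Type*} [Field K] [Fintype K] [CharP K 2] :
    (1 : K) ∈ ((Finset.univ \ {0, 1} : Finset K).image fun z => z + z⁻¹) ↔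
      3 ∣ Fintype.card K - 1 := by
  have h2 : (2 : K) = 0 := CharTwo.two_eq_zero
  rw [← FiniteField.exists_sq_add_self_add_one_eq_zero_iff (K := K)]
  simp only [Finset.mem_image, Finset.mem_sdiff, Finset.mem_univ, true_and, Finset.mem_insert,
    Finset.mem_singleton, not_or]
  constructor
  · rintro ⟨z, ⟨hz0, -⟩, h⟩
    refine ⟨z, ?_⟩
    field_simp at h
    linear_combination h + z * h2
  · rintro ⟨z, hz⟩
    have hz0 : z ≠ 0 := by rintro rfl; simp at hz
    refine ⟨z, ⟨hz0, ?_⟩, ?_⟩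
    · rintro rfl
      exact one_ne_zero (α := K) (by linear_combination hz - h2)
    · field_simp
      linear_combination hz - z * h2

/-- For `q = 2^m > 2` and `c₁ ≠ 0`, the value set of
`F(x) = (x^{q-2} + c₁)^{q-2} + x` (the case `c₀ = 1`) over `F_q` has exactly
`q/2 + Tr(1) - 1` elements, `Tr(1)` being read as the integer `0` or `1`. -/
theorem value_set_card_carlitz_rank_two_char_two_c0_eq_one
    (q m : ℕ) (hq : 2 < q) (hq2 : q = 2 ^ m)
    (K : Type*) [Field K] [Fintype K] (hcard : Fintype.card K = q)
    (c₁ : K) (hc₁ : c₁ ≠ 0) :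
    (Set.ncard (Set.range (fun x : K => (x ^ (q - 2) + c₁) ^ (q - 2) + x)) : ℤ)
      = (q : ℤ) / 2 + (if absTr m (1 : K) = 0 then 0 else 1) - 1 := by
  have : Fact (Nat.Prime 2) := ⟨Nat.prime_two⟩
  have : CharP K 2 := charP_of_card_eq_prime_pow (hcard.trans hq2)
  subst hcard
  simp only [FiniteField.pow_card_sub_two hq]
  rw [range_inv_add_inv_add_self hc₁,
    Set.ncard_image_of_injective _ (mul_right_injective₀ (inv_ne_zero hc₁)),
    Set.ncard_coe_finset, Finset.card_insert_eq_ite]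
  have hiff : absTr m (1 : K) = 0 ↔
      (1 : K) ∈ ((Finset.univ \ {0, 1} : Finset K).image fun z => z + z⁻¹) := by
    rw [one_mem_image_add_inv_iff, hq2, three_dvd_two_pow_sub_one_iff, absTr_one,
      CharP.cast_eq_zero_iff K 2, even_iff_two_dvd]
  have hcount := two_mul_card_image_add_inv (K := K)
  simp only [hiff]
  split_ifs <;> push_cast <;> omega
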